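/- For the KCIP on the torus Λ(L,d) with parameter p=c/n and n>2c, for every initial configuration x∈{0,1}^V and every s≥0, E_x[δ_s] ≤ (1−1/(2n))^s·δ_0(x) + 4cd, where δ_0(x) is the number of particles of x minus the number of connected components of the subgraph induced by the particles of x. -/

import Mathlib

open scoped Classical
open Finset

noncomputable section

/-- The number of particles (vertices labelled `1`) of a configuration. -/
def numParticles {V : Type*} [Fintype V] (x : V → Bool) : ℕ :=
  (Finset.univ.filter fun v => x v = true).card

/-- One-step transition kernel of the kinetically constrained Ising process (KCIP)
on the graph `G` with density parameter `p`: a uniformly chosen vertex `v` is updated,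
and its label is resampled (to `1` with probability `p`, to `0` otherwise) iff `v` has at
least one neighbour labelled `1`. -/
def kcipKernel {V : Type*} [Fintype V] (G : SimpleGraph V) (p : ℝ) (x y : V → Bool) : ℝ :=
  ((Fintype.card V : ℝ))⁻¹ * ∑ v : V,
    (if ∀ w, w ≠ v → y w = x w then
      (if ∃ u, G.Adj u v ∧ x u = true then (if y v = true then p else 1 - p)
       else (if y v = x v then 1 else 0))
     else 0)

/-- Probability that the Markov chain with kernel `K` started at `x` produces a
trajectory `(X_0, …, X_T)` lying in the event `A`. -/
def trajProb {Ω : Type*} [Fintype Ω] (K : Ω → Ω → ℝ) (x : Ω) (T : ℕ)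
    (A : (Fin (T + 1) → Ω) → Prop) : ℝ :=
  ∑ ω : Fin (T + 1) → Ω,
    if ω 0 = x ∧ A ω then ∏ i : Fin T, K (ω i.castSucc) (ω i.succ) else 0

/-- Expectation of a functional `f` of the trajectory `(X_0, …, X_T)` of the Markov chain
with kernel `K` started at `x`. -/
def trajExp {Ω : Type*} [Fintype Ω] (K : Ω → Ω → ℝ) (x : Ω) (T : ℕ)
    (f : (Fin (T + 1) → Ω) → ℝ) : ℝ :=
  ∑ ω : Fin (T + 1) → Ω,
    (if ω 0 = x then ∏ i : Fin T, K (ω i.castSucc) (ω i.succ) else 0) * f ω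

/-- The `d`-dimensional discrete torus `Z_L^d`: vertices are `Fin d → ZMod L`, with an edge
between `u` and `v` iff `u - v = ± e_i` for some coordinate vector `e_i`. -/
def torusGraph (L d : ℕ) : SimpleGraph (Fin d → ZMod L) :=
  SimpleGraph.fromRel fun u v => ∃ i : Fin d, v = u + fun j => if j = i then (1 : ZMod L) else 0

/-- Number of connected components of the subgraph of `G` induced by the particles of `x`. -/
def numComponents {V : Type*} [Fintype V] (G : SimpleGraph V) (x : V → Bool) : ℕ :=
  Nat.card (G.induce {v | x v = true}).ConnectedComponent

/-- The number of excess particles `δ(x) = V(x) − Y(x)`: the number of particles minus the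
number of connected components of the subgraph induced by the particles. -/
def excessParticles {V : Type*} [Fintype V] (G : SimpleGraph V) (x : V → Bool) : ℝ :=
  (numParticles x : ℝ) - (numComponents G x : ℝ)

/-- Removing a vertex with an occupied neighbour does not decrease the number of components. -/
theorem numComponents_le_of_update_false {V : Type*} [Fintype V] [DecidableEq V] (G : SimpleGraph V)
    (x : V → Bool) (v u : V) (huv : G.Adj u v) (hu : x u = true) (hv : x v = true) :
    numComponents G x ≤ numComponents G (Function.update x v false) := by
  have hsub : {w | Function.update x v false w = true} ⊆ {w | x w = true} := by
    intro w hw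
    by_cases h : w = v
    · subst h; exact hv
    · simpa [h] using hw
  let φ := SimpleGraph.induceHomOfLE G hsub
  refine Nat.card_le_card_of_surjective
    (fun C => C.map φ.toHom) ?_
  intro C
  induction C using SimpleGraph.ConnectedComponent.ind with
  | h a =>
    obtain ⟨w, hw⟩ := a
    by_cases h : w = v
    · subst h
      have hu' : Function.update x w false u = true := by
        rw [Function.update_of_ne huv.ne]; exact hu
      refine ⟨SimpleGraph.connectedComponentMk _ ⟨u, hu'⟩, ?_⟩
      refine SimpleGraph.ConnectedComponent.sound (SimpleGraph.Adj.reachable ?_)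
      exact huv
    · have hw' : Function.update x v false w = true := by
        rw [Function.update_of_ne h]; exact hw
      exact ⟨SimpleGraph.connectedComponentMk _ ⟨w, hw'⟩, rfl⟩

/-- A component of an induced subgraph not adjacent to `v` stays closed when `v` is occupied. -/
theorem reachable_of_reachable_update_true {V : Type*} [DecidableEq V] (G : SimpleGraph V)
    (x : V → Bool) (v : V) (a : {w | x w = true})
    (hav : (a : V) ≠ v)
    (hna : ∀ u : {w | x w = true}, (G.induce {w | x w = true}).Reachable a u → ¬ G.Adj u v)
    (a' b : {w | Function.update x v true w = true}) (haa : (a' : V) = a)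
    (h : (G.induce {w | Function.update x v true w = true}).Reachable a' b) :
    (b : V) ≠ v ∧ ∃ hb : x b = true,
      (G.induce {w | x w = true}).Reachable a ⟨b, hb⟩ := by
  rw [SimpleGraph.reachable_iff_reflTransGen] at h
  induction h with
  | refl =>
    obtain ⟨a', ha'⟩ := a'
    subst haa
    exact ⟨hav, a.2, SimpleGraph.Reachable.refl _⟩
  | @tail b c _ hbc ih =>
    obtain ⟨hb, hb', hr⟩ := ih
    have hadj : G.Adj b c := hbc
    have hc : (c : V) ≠ v := fun h => hna _ hr ((congrArg (G.Adj b) h).mp hadj)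
    have hc' : x c = true := by
      rw [← Function.update_of_ne hc true x]
      exact c.2
    refine ⟨hc, hc', hr.trans (SimpleGraph.Adj.reachable ?_)⟩
    exact hadj

/-- Occupying an empty vertex merges at most as many components as its degree. -/
theorem numComponents_add_one_le_of_update_true {V : Type*} [Fintype V] [DecidableEq V] (G : SimpleGraph V)
    (x : V → Bool) (v : V) (hv : x v = false) :
    numComponents G x + 1 ≤
      numComponents G (Function.update x v true) + Nat.card (G.neighborSet v) := by
  have hsub : {w | x w = true} ⊆ {w | Function.update x v true w = true} := by
    intro w hw
    by_cases h : w = v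
    · subst h; simp
    · simpa [h] using hw
  let φ := SimpleGraph.induceHomOfLE G hsub
  let P : (G.induce {w | x w = true}).ConnectedComponent → Prop := fun C =>
    ∃ u : {w | x w = true}, SimpleGraph.connectedComponentMk _ u = C ∧ G.Adj v u
  let cv : (G.induce {w | Function.update x v true w = true}).ConnectedComponent :=
    SimpleGraph.connectedComponentMk _ ⟨v, by simp⟩
  let f : Option (G.induce {w | x w = true}).ConnectedComponent →
      (G.induce {w | Function.update x v true w = true}).ConnectedComponent ⊕
        G.neighborSet v := fun o =>
    match o with
    | none => Sum.inl cv
    | some C => if h : P C then Sum.inr ⟨h.choose, h.choose_spec.2⟩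
        else Sum.inl (C.map φ.toHom)
  have key : ∀ (C : (G.induce {w | x w = true}).ConnectedComponent), ¬ P C →
      ∀ b : {w | Function.update x v true w = true},
      C.map φ.toHom = SimpleGraph.connectedComponentMk _ b →
      (b : V) ≠ v ∧ ∃ hb : x b = true, C = SimpleGraph.connectedComponentMk _ ⟨b, hb⟩ := by
    intro C
    induction C using SimpleGraph.ConnectedComponent.ind with
    | h a =>
      intro hP b hb
      rw [SimpleGraph.ConnectedComponent.map_mk, SimpleGraph.ConnectedComponent.eq] at hb
      have hav : (a : V) ≠ v := by
        intro h
        have : x a = true := a.2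
        rw [h, hv] at this
        exact Bool.noConfusion this
      obtain ⟨h1, h2, h3⟩ := reachable_of_reachable_update_true G x v a hav
        (fun u hu huv => hP ⟨u, SimpleGraph.ConnectedComponent.sound hu.symm, huv.symm⟩)
        _ b rfl hb
      exact ⟨h1, h2, SimpleGraph.ConnectedComponent.sound h3⟩
  have hf : Function.Injective f := by
    intro o o' h
    match o, o' with
    | none, none => rfl
    | none, some C =>
      by_cases hC : P C
      · simp [f, hC] at h
      · simp only [f, hC, dite_false, Sum.inl.injEq] at h
        exact absurd rfl (key C hC _ h.symm).1
    | some C, none =>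
      by_cases hC : P C
      · simp [f, hC] at h
      · simp only [f, hC, dite_false, Sum.inl.injEq] at h
        exact absurd rfl (key C hC _ h).1
    | some C, some C' =>
      by_cases hC : P C <;> by_cases hC' : P C'
      · simp only [f, hC, hC', dite_true, Sum.inr.injEq] at h
        have hval := congrArg Subtype.val h
        have hu : hC.choose = hC'.choose := Subtype.ext hval
        rw [← hC.choose_spec.1, ← hC'.choose_spec.1, hu]
      · simp [f, hC, hC'] at h
      · simp [f, hC, hC'] at h
      · simp only [f, hC, hC', dite_false, Sum.inl.injEq] at h
        induction C' using SimpleGraph.ConnectedComponent.ind with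
        | h b =>
          obtain ⟨_, _, h3⟩ := key C hC (φ b) h
          rw [h3]
          rfl
  have := Nat.card_le_card_of_injective f hf
  rwa [Finite.card_option, Nat.card_sum] at this

theorem numParticles_update_true {V : Type*} [Fintype V] [DecidableEq V] (x : V → Bool) (v : V)
    (hv : x v = false) : numParticles (Function.update x v true) = numParticles x + 1 := by
  unfold numParticles
  rw [← Finset.card_insert_of_notMem (a := v) (by simp [hv])]
  congr 1
  ext w
  by_cases h : w = v <;> simp [h]

theorem numParticles_update_false {V : Type*} [Fintype V] [DecidableEq V] (x : V → Bool) (v : V)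
    (hv : x v = true) : numParticles (Function.update x v false) + 1 = numParticles x := by
  rw [← numParticles_update_true _ v (by simp)]
  congr 1
  simp [← hv]

/-- The excess is at most the number of particles having an occupied neighbour. -/
theorem excessParticles_le_card {V : Type*} [Fintype V] (G : SimpleGraph V) (x : V → Bool) :
    excessParticles G x ≤
      ((univ.filter fun v => x v = true ∧ ∃ u, G.Adj u v ∧ x u = true).card : ℝ) := by
  have hiso : (univ.filter fun v => x v = true ∧ ¬ ∃ u, G.Adj u v ∧ x u = true).card ≤
      numComponents G x := by
    rw [numComponents, ← Fintype.card_coe, ← Nat.card_eq_fintype_card]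
    refine Nat.card_le_card_of_injective
      (fun v => SimpleGraph.connectedComponentMk _
        (⟨v, (Finset.mem_filter.1 v.2).2.1⟩ : {w | x w = true})) ?_
    rintro ⟨v, hv⟩ ⟨w, hw⟩ h
    rw [SimpleGraph.ConnectedComponent.eq, SimpleGraph.reachable_iff_reflTransGen] at h
    rcases h.cases_tail with h | ⟨u, _, hu⟩
    · simpa using h.symm
    · exact absurd ⟨u, hu, u.2⟩ (Finset.mem_filter.1 hw).2.2
  have hsplit : numParticles x =
      (univ.filter fun v => x v = true ∧ ∃ u, G.Adj u v ∧ x u = true).card +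
      (univ.filter fun v => x v = true ∧ ¬ ∃ u, G.Adj u v ∧ x u = true).card := by
    unfold numParticles
    rw [← Finset.filter_filter, ← Finset.filter_filter, Finset.card_filter_add_card_filter_not]
  unfold excessParticles
  rw [hsplit]
  push_cast
  have : ((univ.filter fun v => x v = true ∧ ¬ ∃ u, G.Adj u v ∧ x u = true).card : ℝ) ≤
    numComponents G x := by exact_mod_cast hiso
  linarith

/-- The KCIP kernel acts on a function by averaging over the single-site updates. -/
theorem sum_kcipKernel_mul {V : Type*} [Fintype V] [DecidableEq V] (G : SimpleGraph V) (p : ℝ) (x : V → Bool)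
    (f : (V → Bool) → ℝ) :
    ∑ y, kcipKernel G p x y * f y = ((Fintype.card V : ℝ))⁻¹ * ∑ v : V,
      if ∃ u, G.Adj u v ∧ x u = true then
        p * f (Function.update x v true) + (1 - p) * f (Function.update x v false)
      else f x := by
  simp only [kcipKernel, mul_assoc, ← Finset.mul_sum, Finset.sum_mul]
  congr 1
  rw [Finset.sum_comm]
  refine Finset.sum_congr rfl fun v _ => ?_
  simp only [ite_mul, zero_mul]
  rw [← Finset.sum_filter]
  have himg : (univ.filter fun y : V → Bool => ∀ w, w ≠ v → y w = x w) =
      univ.image fun b : Bool => Function.update x v b := by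
    ext y
    simp only [Finset.mem_filter, Finset.mem_univ, true_and, Finset.mem_image]
    constructor
    · intro h
      exact ⟨y v, (Function.eq_update_iff.2 ⟨rfl, h⟩).symm⟩
    · rintro ⟨b, rfl⟩ w hw
      exact Function.update_of_ne hw _ _
  rw [himg, Finset.sum_image fun a _ b _ h => Function.update_injective x v h,
    Fintype.sum_bool]
  by_cases h : ∃ u, G.Adj u v ∧ x u = true
  · simp [h]
  · simp only [h, if_false, Function.update_self, one_mul]
    cases hx : x v
    · simp [← hx]
    · simp [← hx]

theorem sum_kcipKernel {V : Type*} [Fintype V] [DecidableEq V] [Nonempty V] (G : SimpleGraph V) (p : ℝ)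
    (x : V → Bool) : ∑ y, kcipKernel G p x y = 1 := by
  have h := sum_kcipKernel_mul G p x fun _ => 1
  simpa using h

theorem kcipKernel_nonneg {V : Type*} [Fintype V] (G : SimpleGraph V) {p : ℝ} (h0 : 0 ≤ p)
    (h1 : p ≤ 1) (x y : V → Bool) : 0 ≤ kcipKernel G p x y := by
  unfold kcipKernel
  refine mul_nonneg (by positivity) (Finset.sum_nonneg fun v _ => ?_)
  split_ifs <;> linarith

/-- One-step drift bound for the excess of the KCIP on a graph of maximum degree at most `D`. -/
theorem sum_kcipKernel_mul_excessParticles_le {V : Type*} [Fintype V] [DecidableEq V] [Nonempty V]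
    (G : SimpleGraph V) {p : ℝ} (h0 : 0 ≤ p) (h1 : p ≤ 1 / 2) (D : ℕ)
    (hD : ∀ v, Nat.card (G.neighborSet v) ≤ D) (x : V → Bool) :
    ∑ y, kcipKernel G p x y * excessParticles G y ≤
      (1 - 1 / (2 * (Fintype.card V : ℝ))) * excessParticles G x + p * D := by
  rw [sum_kcipKernel_mul]
  have hstep : ∀ v : V, (if ∃ u, G.Adj u v ∧ x u = true then
        p * excessParticles G (Function.update x v true) +
          (1 - p) * excessParticles G (Function.update x v false)
      else excessParticles G x) ≤ (excessParticles G x + p * D) -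
        1 / 2 * (if x v = true ∧ ∃ u, G.Adj u v ∧ x u = true then 1 else 0) := by
    intro v
    have hpD : 0 ≤ p * D := by positivity
    by_cases h : ∃ u, G.Adj u v ∧ x u = true
    · rw [if_pos h]
      cases hv : x v
      · have e : Function.update x v false = x := by simp [← hv]
        have hc : (numComponents G x : ℝ) + 1 ≤
            numComponents G (Function.update x v true) + D := by
          exact_mod_cast (numComponents_add_one_le_of_update_true G x v hv).trans
            (Nat.add_le_add_left (hD v) _)
        have hd : excessParticles G (Function.update x v true) ≤ excessParticles G x + D := by
          unfold excessParticles
          rw [numParticles_update_true x v hv]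
          push_cast
          linarith
        rw [e]
        simp only [Bool.false_eq_true, false_and, if_false]
        nlinarith [mul_le_mul_of_nonneg_left hd h0]
      · have e : Function.update x v true = x := by simp [← hv]
        obtain ⟨u, hu, hxu⟩ := h
        have hc : (numComponents G x : ℝ) ≤ numComponents G (Function.update x v false) := by
          exact_mod_cast numComponents_le_of_update_false G x v u hu hxu hv
        have hd : excessParticles G (Function.update x v false) ≤ excessParticles G x - 1 := by
          unfold excessParticles
          rw [← numParticles_update_false x v hv]
          push_cast
          linarith
        rw [e, if_pos ⟨rfl, u, hu, hxu⟩]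
        nlinarith [mul_le_mul_of_nonneg_left hd (by linarith : 0 ≤ 1 - p)]
    · rw [if_neg h, if_neg fun h' => h h'.2]
      linarith
  have hn : (0 : ℝ) < Fintype.card V := by exact_mod_cast Fintype.card_pos
  have hsum := Finset.sum_le_sum fun v (_ : v ∈ univ) => hstep v
  rw [Finset.sum_sub_distrib, ← Finset.mul_sum, Finset.sum_boole, Finset.sum_const,
    Finset.card_univ, nsmul_eq_mul] at hsum
  have hle := excessParticles_le_card G x
  calc _ ≤ ((Fintype.card V : ℝ))⁻¹ * ((Fintype.card V : ℝ) * (excessParticles G x + p * D) -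
        1 / 2 * excessParticles G x) :=
        mul_le_mul_of_nonneg_left (by linarith) (by positivity)
    _ = _ := by field_simp; ring

/-- Conditioning on the first step of the chain. -/
theorem trajExp_succ_last {Ω : Type*} [Fintype Ω] (K : Ω → Ω → ℝ) (x : Ω) (T : ℕ)
    (f : Ω → ℝ) :
    trajExp K x (T + 1) (fun ω => f (ω (Fin.last (T + 1)))) =
      ∑ y, K x y * trajExp K y T (fun ω => f (ω (Fin.last T))) := by
  unfold trajExp
  rw [← (Fin.consEquiv fun _ : Fin (T + 2) => Ω).sum_comp, Fintype.sum_prod_type,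
    Finset.sum_eq_single x]
  · simp only [Finset.mul_sum]
    rw [Finset.sum_comm]
    refine Finset.sum_congr rfl fun ω _ => ?_
    rw [Finset.sum_eq_single (ω 0)]
    · simp [Fin.consEquiv, Fin.prod_univ_succ (n := T), ← Fin.succ_last,
        mul_assoc]
    · intro y _ hy
      simp [hy.symm]
    · simp
  · intro y _ hy
    simp [Fin.consEquiv, hy]
  · simp

theorem trajExp_zero_last {Ω : Type*} [Fintype Ω] (K : Ω → Ω → ℝ) (x : Ω) (f : Ω → ℝ) :
    trajExp K x 0 (fun ω => f (ω (Fin.last 0))) = f x := by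
  unfold trajExp
  rw [Finset.sum_eq_single fun _ => x]
  · simp
  · intro ω _ hω
    have : ω 0 ≠ x := fun h => hω (funext fun i => by rw [← h, Fin.fin_one_eq_zero i])
    simp [this]
  · simp

/-- A geometric drift condition for a Markov kernel iterates to a bound at all times. -/
theorem trajExp_le_of_drift {Ω : Type*} [Fintype Ω] (K : Ω → Ω → ℝ) (hK : ∀ x y, 0 ≤ K x y)
    (hK1 : ∀ x, ∑ y, K x y = 1) (f : Ω → ℝ) {a B : ℝ} (ha : 0 ≤ a)
    (hf : ∀ x, ∑ y, K x y * f y ≤ a * f x + B * (1 - a)) (s : ℕ) (x : Ω) :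
    trajExp K x s (fun ω => f (ω (Fin.last s))) ≤ a ^ s * f x + B * (1 - a ^ s) := by
  induction s generalizing x with
  | zero => rw [trajExp_zero_last]; simp
  | succ s ih =>
    rw [trajExp_succ_last]
    calc _ ≤ ∑ y, K x y * (a ^ s * f y + B * (1 - a ^ s)) :=
          Finset.sum_le_sum fun y _ => mul_le_mul_of_nonneg_left (ih y) (hK x y)
      _ = a ^ s * (∑ y, K x y * f y) + (∑ y, K x y) * (B * (1 - a ^ s)) := by
          rw [Finset.mul_sum, Finset.sum_mul, ← Finset.sum_add_distrib]
          exact Finset.sum_congr rfl fun y _ => by ring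
      _ ≤ a ^ s * (a * f x + B * (1 - a)) + (∑ y, K x y) * (B * (1 - a ^ s)) := by
          gcongr
          exact hf x
      _ = _ := by rw [hK1]; ring

theorem card_neighborSet_torusGraph_le (L d : ℕ) (v : Fin d → ZMod L) :
    Nat.card ((torusGraph L d).neighborSet v) ≤ 2 * d := by
  let e : Fin d → Fin d → ZMod L := fun i j => if j = i then 1 else 0
  have hsub : (torusGraph L d).neighborSet v ⊆
      Set.range (Sum.elim (fun i => v + e i) (fun i => v - e i)) := by
    intro w hw
    rw [SimpleGraph.mem_neighborSet, torusGraph, SimpleGraph.fromRel_adj] at hw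
    obtain ⟨_, ⟨i, hi⟩ | ⟨i, hi⟩⟩ := hw
    · exact ⟨Sum.inl i, hi.symm⟩
    · exact ⟨Sum.inr i, sub_eq_of_eq_add hi⟩
  calc _ ≤ Nat.card (Set.range (Sum.elim (fun i => v + e i) (fun i => v - e i))) :=
        Nat.card_mono (Set.finite_range _) hsub
    _ ≤ Nat.card (Fin d ⊕ Fin d) := Finite.card_range_le _
    _ = 2 * d := by simp [two_mul]

/-- For the KCIP on the torus `Λ(L,d)` with `p = c/n` and `n > 2c`: for every
initial configuration `x` and every `s ≥ 0`,
`E_x[δ_s] ≤ (1 − 1/(2n))^s δ_0(x) + 4cd`. -/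
theorem kcip_excess_particles_drift (c : ℝ) (hc : 0 < c) (d L : ℕ)
    (hn : 2 * c < (((L + 1) ^ d : ℕ) : ℝ)) (x : (Fin d → ZMod (L + 1)) → Bool) (s : ℕ) :
    trajExp (kcipKernel (torusGraph (L + 1) d) (c / (((L + 1) ^ d : ℕ) : ℝ))) x s
        (fun ω => excessParticles (torusGraph (L + 1) d) (ω (Fin.last s))) ≤
      (1 - 1 / (2 * (((L + 1) ^ d : ℕ) : ℝ))) ^ s *
          excessParticles (torusGraph (L + 1) d) x +
        4 * c * d := by
  have hcard : Fintype.card (Fin d → ZMod (L + 1)) = (L + 1) ^ d := by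
    simp [ZMod.card]
  set n : ℝ := (((L + 1) ^ d : ℕ) : ℝ) with hn_def
  have hn0 : 0 < n := by positivity
  have hn1 : 1 ≤ n := by 
    rw [hn_def]
    exact_mod_cast Nat.one_le_pow d (L + 1) L.succ_pos
  have hp0 : 0 ≤ c / n := by positivity
  have hp : c / n ≤ 1 / 2 := by rw [div_le_iff₀ hn0]; linarith
  have ha : 0 ≤ 1 - 1 / (2 * n) := by
    have : 1 / (2 * n) ≤ 1 := by rw [div_le_one (by positivity)]; linarith
    linarith
  have hmain := trajExp_le_of_drift (kcipKernel (torusGraph (L + 1) d) (c / n))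
    (kcipKernel_nonneg _ hp0 (by linarith)) (sum_kcipKernel _ _)
    (excessParticles (torusGraph (L + 1) d)) (B := 4 * c * d) ha
    (fun y => by
      have h := sum_kcipKernel_mul_excessParticles_le (torusGraph (L + 1) d) hp0 hp (2 * d)
        (card_neighborSet_torusGraph_le (L + 1) d) y
      rw [hcard] at h
      refine h.trans (le_of_eq ?_)
      rw [← hn_def]
      push_cast
      field_simp
      ring) s x
  have : 0 ≤ 4 * c * d * (1 - 1 / (2 * n)) ^ s := by positivity
  linarith
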